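/- With the convention q(0) = 1, the numbers q(n) of plane partitions satisfy the recurrence n · q(n) = Σ_{k=1}^n q(n − k) · β₂(k) for every integer n ≥ 1, where β₂(k) = Σ_{d | k} d² is the sum of the squares of the positive divisors of k. -/

import Mathlib

open Real Filter

/-- The number of plane partitions of `n` (for `n ≥ 1`). -/
noncomputable def planePartitionCount (n : ℕ) : ℕ :=
  Nat.card {ω : ℕ → ℕ → ℕ //
    (∀ i j, ω (i + 1) j ≤ ω i j) ∧ (∀ i j, ω i (j + 1) ≤ ω i j) ∧
    (∑' p : ℕ × ℕ, ω p.1 p.2) = n}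

/-- The plane partition counting function with the convention `q(0) = 1`. -/
noncomputable def q (n : ℕ) : ℕ := if n = 0 then 1 else planePartitionCount n

/-- `β₂(k)`, the sum of the squares of the positive divisors of `k`. -/
def beta2 (k : ℕ) : ℕ := ∑ d ∈ k.divisors, d ^ 2

open scoped PowerSeries ENNReal

/-- Coefficientwise sum of an arbitrary family of power series over `ℝ≥0∞`. -/
noncomputable def psum {ι : Type*} (f : ι → ℝ≥0∞⟦X⟧) : ℝ≥0∞⟦X⟧ :=
  PowerSeries.mk fun n => ∑' i, PowerSeries.coeff n (f i)

theorem coeff_psum {ι : Type*} (f : ι → ℝ≥0∞⟦X⟧) (n : ℕ) :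
    PowerSeries.coeff n (psum f) = ∑' i, PowerSeries.coeff n (f i) :=
  PowerSeries.coeff_mk _ _

theorem mul_psum {ι : Type*} (a : ℝ≥0∞⟦X⟧) (f : ι → ℝ≥0∞⟦X⟧) :
    a * psum f = psum fun i => a * f i := by
  ext n
  simp only [coeff_psum, PowerSeries.coeff_mul, ← ENNReal.tsum_mul_left]
  rw [Summable.tsum_finsetSum fun _ _ => ENNReal.summable]

theorem psum_mul {ι : Type*} (f : ι → ℝ≥0∞⟦X⟧) (a : ℝ≥0∞⟦X⟧) :
    psum f * a = psum fun i => f i * a := by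
  simp only [mul_comm _ a, mul_psum]

theorem psum_comm {ι κ : Type*} (f : ι → κ → ℝ≥0∞⟦X⟧) :
    (psum fun i => psum fun j => f i j) = psum fun j => psum fun i => f i j := by
  ext n
  simp only [coeff_psum]
  exact ENNReal.tsum_comm

theorem psum_prod {ι κ : Type*} (f : ι × κ → ℝ≥0∞⟦X⟧) :
    psum f = psum fun i => psum fun j => f (i, j) := by
  ext n
  simp only [coeff_psum]
  exact ENNReal.tsum_prod' (f := fun p => PowerSeries.coeff n (f p))

theorem psum_equiv {ι κ : Type*} (e : ι ≃ κ) (f : κ → ℝ≥0∞⟦X⟧) :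
    (psum fun i => f (e i)) = psum f := by
  ext n
  simp only [coeff_psum]
  exact e.tsum_eq fun j => PowerSeries.coeff n (f j)

theorem psum_ite {ι : Type*} (p : ι → Prop) [DecidablePred p] (f : ι → ℝ≥0∞⟦X⟧) :
    (psum fun i => if p i then f i else 0) = psum fun i : {i // p i} => f i := by
  ext n
  simp only [coeff_psum]
  rw [show (∑' i : {i // p i}, PowerSeries.coeff n (f i)) =
    ∑' i, Set.indicator {i | p i} (fun i => PowerSeries.coeff n (f i)) i from
      tsum_subtype {i | p i} fun i => PowerSeries.coeff n (f i)]
  congr 1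
  ext i
  by_cases h : p i <;> simp [h]

theorem psum_eq_single {ι : Type*} (i₀ : ι) (f : ι → ℝ≥0∞⟦X⟧) (h : ∀ i, i ≠ i₀ → f i = 0) :
    psum f = f i₀ := by
  ext n
  rw [coeff_psum, tsum_eq_single i₀]
  intro i hi
  simp [h i hi]

/-- `ν` and `κ` interlace: `ν 0 ≥ κ 0 ≥ ν 1 ≥ κ 1 ≥ ⋯`. -/
def Interlace (ν κ : ℕ →₀ ℕ) : Prop := ∀ i, κ i ≤ ν i ∧ ν (i + 1) ≤ κ i

theorem degree_eq_sum_range (κ : ℕ →₀ ℕ) {N : ℕ} (h : ∀ i, N ≤ i → κ i = 0) :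
    κ.degree = ∑ i ∈ Finset.range N, κ i := by
  rw [Finsupp.degree_apply]
  refine Finset.sum_subset (fun i hi => ?_) (fun i _ hi => by simpa using hi)
  by_contra hN
  exact (Finsupp.mem_support_iff.mp hi) (h i (by simpa using hN))

theorem exists_forall_ge_eq_zero (κ : ℕ →₀ ℕ) : ∃ N, ∀ i, N ≤ i → κ i = 0 := by
  obtain ⟨N, hN⟩ := κ.support.exists_nat_subset_range
  refine ⟨N, fun i hi => ?_⟩
  by_contra h
  have := hN (Finsupp.mem_support_iff.mpr h)
  simp at this
  omega

theorem Interlace.degree_le {ν κ : ℕ →₀ ℕ} (h : Interlace ν κ) : κ.degree ≤ ν.degree :=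
  Finsupp.degree_mono fun i => (h i).1

/-- The local growth rule: the partitions interlacing above both `κ` and `μ` correspond to
those interlacing below both, together with a natural number. -/
noncomputable def growthEquiv (κ μ : ℕ →₀ ℕ) :
    {ν : ℕ →₀ ℕ // Interlace ν κ ∧ Interlace ν μ} ≃
      {ρ : ℕ →₀ ℕ // Interlace κ ρ ∧ Interlace μ ρ} × ℕ where
  toFun ν :=
    (⟨Finsupp.ofSupportFinite
        (fun i => max (κ (i + 1)) (μ (i + 1)) + min (κ i) (μ i) - ν.1 (i + 1))
        (κ.support.finite_toSet.subset fun i hi => by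
          have h1 := ν.2.1 (i + 1)
          have h2 := ν.2.2 (i + 1)
          simp only [Function.mem_support, Finset.mem_coe, Finsupp.mem_support_iff] at hi ⊢
          omega),
      by
        constructor <;> intro i <;> simp only [Finsupp.ofSupportFinite_coe] <;>
        · have h1 := ν.2.1 (i + 1)
          have h2 := ν.2.2 (i + 1)
          have h3 := ν.2.1 i
          have h4 := ν.2.2 i
          omega⟩,
      ν.1 0 - max (κ 0) (μ 0))
  invFun p :=
    ⟨Finsupp.ofSupportFinite
        (fun i => Nat.casesOn i (max (κ 0) (μ 0) + p.2)
          fun i => max (κ (i + 1)) (μ (i + 1)) + min (κ i) (μ i) - p.1.1 i)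
        (((κ.support.image Nat.succ) ∪ {0}).finite_toSet.subset fun i hi => by
          rcases i with _ | i
          · simp
          · have h1 := p.1.2.1 i
            have h2 := p.1.2.2 i
            simp only [Function.mem_support] at hi
            simp
            omega),
      by
        constructor <;> rintro (_ | i) <;> simp only [Finsupp.ofSupportFinite_coe, Nat.rec_zero]
        · have h1 := p.1.2.1 0
          have h2 := p.1.2.2 0
          omega
        · have h1 := p.1.2.1 (i + 1)
          have h2 := p.1.2.2 (i + 1)
          have h3 := p.1.2.1 i
          have h4 := p.1.2.2 i
          omega
        · have h1 := p.1.2.1 0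
          have h2 := p.1.2.2 0
          omega
        · have h1 := p.1.2.1 (i + 1)
          have h2 := p.1.2.2 (i + 1)
          have h3 := p.1.2.1 i
          have h4 := p.1.2.2 i
          omega⟩
  left_inv ν := by
    ext i
    rcases i with _ | i
    · have h1 := ν.2.1 0
      have h2 := ν.2.2 0
      simp only [Finsupp.ofSupportFinite_coe, Nat.rec_zero]
      omega
    · have h1 := ν.2.1 (i + 1)
      have h2 := ν.2.2 (i + 1)
      have h3 := ν.2.1 i
      have h4 := ν.2.2 i
      simp only [Finsupp.ofSupportFinite_coe]
      omega
  right_inv p := by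
    refine Prod.ext (Subtype.ext (Finsupp.ext fun i => ?_)) ?_
    · have h1 := p.1.2.1 i
      have h2 := p.1.2.2 i
      simp only [Finsupp.ofSupportFinite_coe]
      omega
    · simp only [Finsupp.ofSupportFinite_coe, Nat.rec_zero]
      omega

theorem growthEquiv_degree (κ μ : ℕ →₀ ℕ) (ν : {ν : ℕ →₀ ℕ // Interlace ν κ ∧ Interlace ν μ}) :
    ν.1.degree + (growthEquiv κ μ ν).1.1.degree =
      κ.degree + μ.degree + (growthEquiv κ μ ν).2 := by
  obtain ⟨N, hN⟩ := exists_forall_ge_eq_zero ν.1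
  have hκ : ∀ i, N ≤ i → κ i = 0 := fun i hi => by
    have := (ν.2.1 i).1
    have := hN i hi
    omega
  have hμ : ∀ i, N ≤ i → μ i = 0 := fun i hi => by
    have := (ν.2.2 i).1
    have := hN i hi
    omega
  have hρ : ∀ i, N ≤ i → (growthEquiv κ μ ν).1.1 i = 0 := fun i hi => by
    have := ((growthEquiv κ μ ν).1.2.1 i).1
    have := hκ i hi
    omega
  rw [degree_eq_sum_range ν.1 (N := N + 1) fun i hi => hN i (by omega),
    degree_eq_sum_range _ hρ, Finset.sum_range_succ', add_right_comm, ← Finset.sum_add_distrib]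
  have key : ∀ i, ν.1 (i + 1) + (growthEquiv κ μ ν).1.1 i =
      max (κ (i + 1)) (μ (i + 1)) + min (κ i) (μ i) := fun i => by
    have h1 := ν.2.1 i
    have h2 := ν.2.2 i
    have h3 := ν.2.1 (i + 1)
    have h4 := ν.2.2 (i + 1)
    simp only [growthEquiv, Equiv.coe_fn_mk, Finsupp.ofSupportFinite_coe]
    omega
  have h0 : ν.1 0 = max (κ 0) (μ 0) + (growthEquiv κ μ ν).2 := by
    have h1 := ν.2.1 0
    have h2 := ν.2.2 0
    simp only [growthEquiv, Equiv.coe_fn_mk]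
    omega
  simp only [key, h0]
  rw [Finset.sum_add_distrib, ← add_assoc, add_right_comm (∑ i ∈ _, _),
    ← Finset.sum_range_succ' (fun i => max (κ i) (μ i)), Finset.sum_range_succ,
    hκ N le_rfl, hμ N le_rfl, max_self, add_zero, ← Finset.sum_add_distrib,
    degree_eq_sum_range κ hκ, degree_eq_sum_range μ hμ, ← Finset.sum_add_distrib]
  simp only [max_add_min]

/-- The geometric series `∑ m, X ^ (e * m)`. -/
noncomputable def geom (e : ℕ) : ℝ≥0∞⟦X⟧ := psum fun m : ℕ => PowerSeries.X ^ (e * m)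

open Classical in
/-- The one-variable skew Schur function of `ν / κ` evaluated at `X ^ k`. -/
noncomputable def skewWeight (k : ℕ) (κ ν : ℕ →₀ ℕ) : ℝ≥0∞⟦X⟧ :=
  if Interlace ν κ then PowerSeries.X ^ (k * (ν.degree - κ.degree)) else 0

theorem psum_skewWeight_mul (j k : ℕ) (κ μ : ℕ →₀ ℕ) :
    (psum fun ν => skewWeight j κ ν * skewWeight k μ ν) =
      geom (j + k) * psum fun ρ => skewWeight k ρ κ * skewWeight j ρ μ := by
  classical
  have hl : (psum fun ν => skewWeight j κ ν * skewWeight k μ ν) =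
      psum fun ν : {ν : ℕ →₀ ℕ // Interlace ν κ ∧ Interlace ν μ} =>
        PowerSeries.X ^ (j * (ν.1.degree - κ.degree) + k * (ν.1.degree - μ.degree)) := by
    rw [← psum_ite _ fun ν : ℕ →₀ ℕ =>
      PowerSeries.X ^ (j * (ν.degree - κ.degree) + k * (ν.degree - μ.degree))]
    congr 1
    ext1
    simp only [skewWeight, pow_add]
    split_ifs <;> simp_all
  have hr : (psum fun ρ => skewWeight k ρ κ * skewWeight j ρ μ) =
      psum fun ρ : {ρ : ℕ →₀ ℕ // Interlace κ ρ ∧ Interlace μ ρ} =>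
        PowerSeries.X ^ (k * (κ.degree - ρ.1.degree) + j * (μ.degree - ρ.1.degree)) := by
    rw [← psum_ite _ fun ρ : ℕ →₀ ℕ =>
      PowerSeries.X ^ (k * (κ.degree - ρ.degree) + j * (μ.degree - ρ.degree))]
    congr 1
    ext1
    simp only [skewWeight, pow_add]
    split_ifs <;> simp_all
  rw [hl, hr, geom, mul_psum]
  simp only [psum_mul]
  rw [← psum_prod fun p : {ρ : ℕ →₀ ℕ // Interlace κ ρ ∧ Interlace μ ρ} × ℕ =>
    (PowerSeries.X ^ ((j + k) * p.2) * PowerSeries.X ^ (k * (κ.degree - p.1.1.degree) +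
      j * (μ.degree - p.1.1.degree)) : ℝ≥0∞⟦X⟧), ← psum_equiv (growthEquiv κ μ)]
  congr 1
  ext1 ν
  rw [← pow_add]
  congr 1
  have h := growthEquiv_degree κ μ ν
  have h1 := ν.2.1.degree_le
  have h2 := ν.2.2.degree_le
  have h3 := (growthEquiv κ μ ν).1.2.1.degree_le
  have h4 := (growthEquiv κ μ ν).1.2.2.degree_le
  rw [show ν.1.degree - κ.degree =
      μ.degree - (growthEquiv κ μ ν).1.1.degree + (growthEquiv κ μ ν).2 by omega,
    show ν.1.degree - μ.degree =
      κ.degree - (growthEquiv κ μ ν).1.1.degree + (growthEquiv κ μ ν).2 by omega]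
  ring

open Classical in
/-- The Schur function of `κ` in the variables `X ^ k, X ^ (k + 1), …, X ^ (k + a - 1)`. -/
noncomputable def schurWeight : ℕ → ℕ → (ℕ →₀ ℕ) → ℝ≥0∞⟦X⟧
  | 0, _, κ => if κ = 0 then 1 else 0
  | a + 1, k, κ => psum fun μ => schurWeight a (k + 1) μ * skewWeight k μ κ

theorem interlace_zero_left {κ : ℕ →₀ ℕ} : Interlace 0 κ ↔ κ = 0 := by
  constructor
  · intro h
    ext i
    simpa using (h i).1
  · rintro rfl i
    simp

theorem skewWeight_zero_right (k : ℕ) (κ : ℕ →₀ ℕ) :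
    skewWeight k κ 0 = if κ = 0 then 1 else 0 := by
  by_cases h : κ = 0 <;> simp [skewWeight, interlace_zero_left, h]

theorem schurWeight_zero_right (a k : ℕ) : schurWeight a k 0 = 1 := by
  induction a generalizing k with
  | zero => simp [schurWeight]
  | succ a ih =>
    rw [schurWeight, psum_eq_single 0]
    · simp [ih, skewWeight_zero_right]
    · intro κ h
      simp [skewWeight_zero_right, h]

theorem psum_schurWeight_mul_skewWeight (a k j : ℕ) (μ : ℕ →₀ ℕ) :
    (psum fun κ => schurWeight a k κ * skewWeight j μ κ) =
      (∏ i ∈ Finset.range a, geom (k + i + j)) * schurWeight a k μ := by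
  induction a generalizing k μ with
  | zero =>
    rw [psum_eq_single 0]
    · simp [schurWeight, skewWeight_zero_right]
    · intro κ h
      simp [schurWeight, h]
  | succ a ih =>
    simp only [schurWeight, psum_mul]
    rw [psum_comm]
    simp only [mul_assoc, ← mul_psum, psum_skewWeight_mul]
    simp only [mul_psum]
    rw [psum_comm]
    have h : ∀ ρ ρ', schurWeight a (k + 1) ρ' *
        (geom (k + j) * (skewWeight j ρ ρ' * skewWeight k ρ μ)) =
        geom (k + j) * ((schurWeight a (k + 1) ρ' * skewWeight j ρ ρ') * skewWeight k ρ μ) :=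
      fun ρ ρ' => by ring
    simp only [h, ← mul_psum, ← psum_mul, ih]
    simp only [mul_assoc, ← mul_psum]
    rw [Finset.prod_range_succ', add_zero]
    simp only [add_assoc, add_comm 1]
    ring

/-- The Cauchy identity at powers of `X`. -/
theorem psum_schurWeight_mul_schurWeight (a b k j : ℕ) :
    (psum fun κ => schurWeight a k κ * schurWeight b j κ) =
      ∏ i' ∈ Finset.range b, ∏ i ∈ Finset.range a, geom (k + i + (j + i')) := by
  induction b generalizing j with
  | zero =>
    rw [psum_eq_single 0]
    · simp [schurWeight, schurWeight_zero_right]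
    · intro κ h
      simp [schurWeight, h]
  | succ b ih =>
    simp only [schurWeight, mul_psum]
    rw [psum_comm]
    simp only [mul_left_comm (schurWeight a k _), ← mul_psum, psum_schurWeight_mul_skewWeight]
    simp only [mul_left_comm (schurWeight b _ _), ← mul_psum]
    simp only [mul_comm (schurWeight b _ _), ih, Finset.prod_range_succ', add_zero,
      add_right_comm j 1, ← add_assoc j]
    rw [mul_comm]

/-- The power series `1 / (1 - X ^ e)` for `e ≥ 1`. -/
def geomNat (e : ℕ) : ℕ⟦X⟧ := PowerSeries.mk fun k => if e ∣ k then 1 else 0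

/-- The series `e * X ^ e / (1 - X ^ e)`, logarithmic Euler derivative of `geomNat e`. -/
def logDerivGeom (e : ℕ) : ℕ⟦X⟧ := PowerSeries.mk fun k => if k ≠ 0 ∧ e ∣ k then e else 0

theorem X_mul_derivative_geomNat (e : ℕ) :
    PowerSeries.X * PowerSeries.derivative ℕ (geomNat e) = geomNat e * logDerivGeom e := by
  ext n
  rcases n with _ | n
  · simp [logDerivGeom]
  rw [PowerSeries.coeff_succ_X_mul, PowerSeries.coeff_derivative, PowerSeries.coeff_mul]
  simp only [geomNat, logDerivGeom, PowerSeries.coeff_mk]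
  rw [Finset.Nat.sum_antidiagonal_eq_sum_range_succ_mk, ← Finset.sum_range_reflect,
    Finset.sum_range_succ']
  by_cases h : e ∣ n + 1
  · have h1 : ∀ k ∈ Finset.range (n + 1),
        ((if e ∣ n + 1 + 1 - 1 - (k + 1) then 1 else 0) *
          if n + 1 - (n + 1 + 1 - 1 - (k + 1)) ≠ 0 ∧ e ∣ n + 1 - (n + 1 + 1 - 1 - (k + 1))
            then e else 0) = if e ∣ k + 1 then e else 0 := fun k hk => by
      have hk : k + 1 ≤ n + 1 := by simpa using hk
      have h2 : n + 1 - (n + 1 + 1 - 1 - (k + 1)) = k + 1 := by omega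
      have h3 : e ∣ k + 1 → e ∣ n + 1 + 1 - 1 - (k + 1) := fun h4 => Nat.dvd_sub h h4
      rw [h2]
      split_ifs <;> simp_all
    rw [Finset.sum_congr rfl h1, ← Finset.sum_filter, Finset.sum_const, Nat.card_multiples]
    simp [h, Nat.div_mul_cancel h]
  · rw [if_neg h, zero_mul, Finset.sum_eq_zero]
    · simp
    · intro k hk
      have hk : k + 1 ≤ n + 1 := by simpa using hk
      have h2 : n + 1 - (n + 1 + 1 - 1 - (k + 1)) = k + 1 := by omega
      rw [h2]
      split_ifs with h3 h4
      · exact absurd ((Nat.dvd_add_right h3).mpr h4.2) (by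
          rwa [show n + 1 + 1 - 1 - (k + 1) + (k + 1) = n + 1 by omega])
      all_goals simp

theorem X_mul_derivative_prod {ι : Type*} (s : Finset ι) (e : ι → ℕ) :
    PowerSeries.X * PowerSeries.derivative ℕ (∏ i ∈ s, geomNat (e i)) =
      (∏ i ∈ s, geomNat (e i)) * ∑ i ∈ s, logDerivGeom (e i) := by
  classical
  induction s using Finset.induction_on with
  | empty => simp
  | insert a s ha ih =>
    rw [Finset.prod_insert ha, Finset.sum_insert ha, Derivation.leibniz, smul_eq_mul, smul_eq_mul,
      mul_add, mul_left_comm, ih, mul_left_comm PowerSeries.X, X_mul_derivative_geomNat]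
    ring

theorem coeff_sum_logDerivGeom {N k : ℕ} (hk : 1 ≤ k) (hkN : k ≤ N) :
    PowerSeries.coeff k (∑ p ∈ Finset.range N ×ˢ Finset.range N, logDerivGeom (p.1 + p.2 + 1)) =
      beta2 k := by
  simp only [map_sum, logDerivGeom, PowerSeries.coeff_mk, beta2]
  rw [← Finset.sum_filter]
  have h : ∀ d ∈ k.divisors, d ^ 2 = ∑ _i ∈ Finset.range d, d := fun d _ => by simp [sq]
  rw [Finset.sum_congr rfl h, Finset.sum_sigma']
  refine Finset.sum_nbij' (fun p => ⟨p.1 + p.2 + 1, p.1⟩) (fun x => (x.2, x.1 - x.2 - 1))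
    ?_ ?_ ?_ ?_ ?_
  · rintro ⟨i, j⟩ hp
    simp at hp ⊢
    omega
  · rintro ⟨d, i⟩ hx
    simp at hx ⊢
    have := Nat.le_of_dvd hk hx.1.1
    rw [show i + (d - i - 1) + 1 = d by omega]
    exact ⟨⟨by omega, by omega⟩, hx.1.symm⟩
  · rintro ⟨i, j⟩ hp
    simp
    omega
  · rintro ⟨d, i⟩ hx
    simp at hx ⊢
    omega
  · intros
    rfl

theorem mul_coeff_prod_geomNat {N n : ℕ} (hn : 1 ≤ n) (hnN : n ≤ N) :
    n * PowerSeries.coeff n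
        (∏ p ∈ Finset.range N ×ˢ Finset.range N, geomNat (p.1 + p.2 + 1)) =
      ∑ k ∈ Finset.Icc 1 n, PowerSeries.coeff (n - k)
        (∏ p ∈ Finset.range N ×ˢ Finset.range N, geomNat (p.1 + p.2 + 1)) * beta2 k := by
  have h := congrArg (PowerSeries.coeff n)
    (X_mul_derivative_prod (Finset.range N ×ˢ Finset.range N) fun p => p.1 + p.2 + 1)
  obtain ⟨n, rfl⟩ := Nat.exists_eq_add_of_le' hn
  rw [PowerSeries.coeff_succ_X_mul, PowerSeries.coeff_derivative, mul_comm] at h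
  rw [← Nat.cast_succ, Nat.cast_id] at h
  rw [Nat.succ_eq_add_one] at h
  rw [h, mul_comm (Finset.prod _ _), PowerSeries.coeff_mul,
    Finset.Nat.sum_antidiagonal_eq_sum_range_succ_mk, Finset.sum_range_succ']
  have h0 : PowerSeries.coeff 0 (∑ p ∈ Finset.range N ×ˢ Finset.range N,
      logDerivGeom (p.1 + p.2 + 1)) = 0 := by
    simp [-PowerSeries.coeff_zero_eq_constantCoeff, logDerivGeom]
  rw [h0, zero_mul, add_zero, Finset.range_eq_Ico,
    Finset.sum_Ico_add' (fun k => PowerSeries.coeff k _ * PowerSeries.coeff (n + 1 - k) _) 0 (n + 1) 1]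
  refine Finset.sum_congr rfl fun k hk => ?_
  have hk : 1 ≤ k ∧ k ≤ n + 1 := by
    simp at hk
    omega
  rw [coeff_sum_logDerivGeom hk.1 (hk.2.trans hnN), mul_comm]

/-- Chains `c 0, c 1, …` of partitions, successively interlacing, with `c d = 0` for `a ≤ d`. -/
abbrev DiagChain (a : ℕ) : Type :=
  {c : ℕ → ℕ →₀ ℕ // (∀ d, Interlace (c d) (c (d + 1))) ∧ ∀ d, a ≤ d → c d = 0}

/-- Prepending a partition to a chain. -/
def consChain (a : ℕ) (κ : ℕ →₀ ℕ) :
    {c : DiagChain (a + 1) // c.1 0 = κ} ≃ {c : DiagChain a // Interlace κ (c.1 0)} where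
  toFun c := ⟨⟨fun d => c.1.1 (d + 1), fun d => c.1.2.1 (d + 1),
    fun d hd => c.1.2.2 (d + 1) (by omega)⟩, by
      have h := c.1.2.1 0
      rwa [c.2] at h⟩
  invFun c := ⟨⟨fun d => Nat.casesOn d κ c.1.1, fun d => by
      cases d with
      | zero => exact c.2
      | succ d => exact c.1.2.1 d,
    fun d hd => by
      cases d with
      | zero => omega
      | succ d => exact c.1.2.2 d (by omega)⟩, rfl⟩
  left_inv c := by
    refine Subtype.ext (Subtype.ext (funext fun d => ?_))
    cases d with
    | zero => exact c.2.symm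
    | succ d => rfl
  right_inv c := rfl

open Classical in
theorem schurWeight_eq_psum (a k : ℕ) (κ : ℕ →₀ ℕ) :
    schurWeight a k κ = psum fun c : DiagChain a =>
      if c.1 0 = κ then
        PowerSeries.X ^ (k * κ.degree + ∑ d ∈ Finset.range a, (c.1 (d + 1)).degree)
      else 0 := by
  induction a generalizing k κ with
  | zero =>
    rw [psum_eq_single (⟨fun _ => 0, fun _ _ => by simp, fun _ _ => rfl⟩ : DiagChain 0)]
    · by_cases h : κ = 0
      · simp [schurWeight, h]
      · simp [schurWeight, h, Ne.symm h]
    · intro c hc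
      exact absurd (Subtype.ext (funext fun d => c.2.2 d (Nat.zero_le d))) hc
  | succ a ih =>
    rw [schurWeight]
    simp only [ih, psum_mul]
    rw [psum_comm]
    have h : ∀ c : DiagChain a, (psum fun μ => (if c.1 0 = μ then
        PowerSeries.X ^ ((k + 1) * μ.degree + ∑ d ∈ Finset.range a, (c.1 (d + 1)).degree)
        else 0) * skewWeight k μ κ) = if Interlace κ (c.1 0) then PowerSeries.X ^
          (k * κ.degree + ∑ d ∈ Finset.range (a + 1), (c.1 d).degree) else 0 := fun c => by
      rw [psum_eq_single (c.1 0)]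
      · rw [if_pos rfl, skewWeight, mul_ite, mul_zero, ← pow_add]
        split_ifs with hc
        · congr 1
          obtain ⟨m, hm⟩ := Nat.exists_eq_add_of_le hc.degree_le
          rw [Finset.sum_range_succ', hm, Nat.add_sub_cancel_left]
          ring
        · rfl
      · intro μ hμ
        rw [if_neg hμ.symm, zero_mul]
    simp only [h]
    rw [psum_ite, psum_ite, ← psum_equiv (consChain a κ)]
    rfl

theorem coeff_psum_X_pow {ι : Type*} (w : ι → ℕ) (n : ℕ) :
    PowerSeries.coeff n (psum fun i => PowerSeries.X ^ w i) = ENat.card {i // w i = n} := by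
  classical
  rw [← ENNReal.tsum_one, coeff_psum]
  refine (tsum_congr fun i => ?_).trans (tsum_subtype {i | w i = n} fun _ => (1 : ℝ≥0∞)).symm
  by_cases h : w i = n
  · simp [PowerSeries.coeff_X_pow, h]
  · simp [PowerSeries.coeff_X_pow, h, Ne.symm h]

theorem geom_eq_map {e : ℕ} (he : e ≠ 0) :
    geom e = PowerSeries.map (Nat.castRingHom ℝ≥0∞) (geomNat e) := by
  ext n
  simp only [geom, geomNat, coeff_psum, PowerSeries.coeff_X_pow, PowerSeries.coeff_map,
    PowerSeries.coeff_mk]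
  by_cases h : e ∣ n
  · obtain ⟨m, rfl⟩ := h
    rw [tsum_eq_single m]
    · simp
    · intro m' hm
      simp [he, hm.symm]
  · rw [if_neg h, map_zero, ENNReal.tsum_eq_zero]
    intro m
    rw [if_neg]
    rintro rfl
    exact h (dvd_mul_right e m)

/-- Pairs of diagonal chains with a common first term: the diagonals on and above, and on and
below, the main diagonal of an array. -/
abbrev DiagPair (N : ℕ) : Type := {p : DiagChain N × DiagChain N // p.1.1 0 = p.2.1 0}

/-- The sum of the entries of the array with given diagonals. -/
noncomputable def DiagPair.size {N : ℕ} (p : DiagPair N) : ℕ :=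
  (p.1.1.1 0).degree + ∑ d ∈ Finset.range N, (p.1.1.1 (d + 1)).degree +
    ∑ d ∈ Finset.range N, (p.1.2.1 (d + 1)).degree

theorem card_diagPair (N n : ℕ) :
    Nat.card {p : DiagPair N // p.size = n} = PowerSeries.coeff n
      (∏ p ∈ Finset.range N ×ˢ Finset.range N, geomNat (p.1 + p.2 + 1)) := by
  classical
  have h := psum_schurWeight_mul_schurWeight N N 0 1
  simp only [schurWeight_eq_psum, psum_mul, mul_psum] at h
  rw [psum_comm] at h
  simp only [psum_comm (ι := ℕ →₀ ℕ)] at h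
  have h1 : ∀ c c' : DiagChain N, (psum fun κ : ℕ →₀ ℕ =>
      (if c.1 0 = κ then (PowerSeries.X : ℝ≥0∞⟦X⟧) ^
        (0 * κ.degree + ∑ d ∈ Finset.range N, (c.1 (d + 1)).degree) else 0) *
      if c'.1 0 = κ then
        PowerSeries.X ^ (1 * κ.degree + ∑ d ∈ Finset.range N, (c'.1 (d + 1)).degree) else 0) =
      if c.1 0 = c'.1 0 then PowerSeries.X ^ ((c.1 0).degree +
        ∑ d ∈ Finset.range N, (c.1 (d + 1)).degree +
        ∑ d ∈ Finset.range N, (c'.1 (d + 1)).degree) else 0 := fun c c' => by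
    rw [psum_eq_single (c.1 0)]
    · rw [if_pos rfl, mul_ite, mul_zero, ← pow_add]
      by_cases hc : c.1 0 = c'.1 0
      · rw [if_pos hc, if_pos hc.symm]
        congr 1
        ring
      · rw [if_neg hc, if_neg (Ne.symm hc)]
    · intro κ hκ
      rw [if_neg hκ.symm, zero_mul]
  simp only [h1] at h
  rw [psum_comm, ← psum_prod fun p : DiagChain N × DiagChain N => if p.1.1 0 = p.2.1 0 then
    PowerSeries.X ^ ((p.1.1 0).degree + ∑ d ∈ Finset.range N, (p.1.1 (d + 1)).degree +
      ∑ d ∈ Finset.range N, (p.2.1 (d + 1)).degree) else (0 : ℝ≥0∞⟦X⟧), psum_ite,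
    ← Finset.prod_product'] at h
  have h2 : ∏ p ∈ Finset.range N ×ˢ Finset.range N, geom (0 + p.2 + (1 + p.1)) =
      PowerSeries.map (Nat.castRingHom ℝ≥0∞)
        (∏ p ∈ Finset.range N ×ˢ Finset.range N, geomNat (p.1 + p.2 + 1)) := by
    rw [map_prod]
    refine Finset.prod_congr rfl fun p _ => ?_
    rw [← geom_eq_map (show p.1 + p.2 + 1 ≠ 0 by omega)]
    congr 1
    ring
  rw [h2] at h
  have h3 := (coeff_psum_X_pow (DiagPair.size (N := N)) n).symm.trans
    (congrArg (PowerSeries.coeff n) h)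
  rw [PowerSeries.coeff_map, Nat.coe_castRingHom, ← ENat.toENNReal_coe,
    ENat.toENNReal_inj] at h3
  rw [Nat.card, ← Cardinal.toNat_toENat, ← ENat.card, h3, ENat.toNat_natCast]

/-- The `d`-th diagonal above the main one of an array vanishing outside `[0, N) × [0, N)`. -/
noncomputable def arrayDiag (N : ℕ) (ω : ℕ → ℕ → ℕ) (h : ∀ i j, N ≤ i → ω i j = 0) (d : ℕ) :
    ℕ →₀ ℕ :=
  Finsupp.onFinset (Finset.range N) (fun i => ω i (i + d)) fun i hi => by
    by_contra hN
    exact hi (h i _ (by simpa using hN))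

theorem DiagChain.apply_eq_zero {N : ℕ} (c : DiagChain N) {d i : ℕ} (h : N ≤ i + d) :
    c.1 d i = 0 := by
  induction i generalizing d with
  | zero => rw [c.2.2 d (by omega), Finsupp.zero_apply]
  | succ i ih =>
    have h1 := (c.2.1 d i).2
    have h2 := ih (d := d + 1) (by omega)
    omega

theorem tsum_eq_sum_diagonals {N : ℕ} {ω : ℕ → ℕ → ℕ} (h : ∀ i j, N ≤ i ∨ N ≤ j → ω i j = 0) :
    ∑' p : ℕ × ℕ, ω p.1 p.2 = ∑ i ∈ Finset.range N, ω i i +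
      ∑ d ∈ Finset.range N, ∑ i ∈ Finset.range N, ω i (i + (d + 1)) +
      ∑ d ∈ Finset.range N, ∑ i ∈ Finset.range N, ω (i + (d + 1)) i := by
  set M := 2 * N + 1
  have hd : ∑ p ∈ Finset.range M ×ˢ Finset.range M with p.1 = p.2, ω p.1 p.2 =
      ∑ i ∈ Finset.range N, ω i i := by
    symm
    refine Finset.sum_of_injOn (fun i => (i, i)) (fun i _ j _ hij => by simpa using hij)
      (fun i hi => by simp at hi ⊢; omega) ?_ (fun _ _ => rfl)
    rintro ⟨i, j⟩ hp hn
    obtain rfl : i = j := by simp at hp; exact hp.2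
    simp at hn
    exact h i i (Or.inl hn)
  have hu : ∑ p ∈ Finset.range M ×ˢ Finset.range M with p.1 < p.2, ω p.1 p.2 =
      ∑ d ∈ Finset.range N, ∑ i ∈ Finset.range N, ω i (i + (d + 1)) := by
    rw [← Finset.sum_product']
    symm
    refine Finset.sum_of_injOn (fun x => (x.2, x.2 + (x.1 + 1))) ?_ ?_ ?_ (fun _ _ => rfl)
    · rintro ⟨d, i⟩ _ ⟨d', i'⟩ _ he
      simp at he ⊢
      omega
    · rintro ⟨d, i⟩ hx
      simp at hx ⊢
      omega
    · rintro ⟨i, j⟩ hp hn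
      by_contra h0
      have h1 : ¬ (N ≤ i ∨ N ≤ j) := fun h2 => h0 (h i j h2)
      refine hn ⟨(j - i - 1, i), ?_, ?_⟩ <;> simp at hp ⊢ <;> omega
  have hl : ∑ p ∈ Finset.range M ×ˢ Finset.range M with p.2 < p.1, ω p.1 p.2 =
      ∑ d ∈ Finset.range N, ∑ i ∈ Finset.range N, ω (i + (d + 1)) i := by
    rw [← Finset.sum_product']
    symm
    refine Finset.sum_of_injOn (fun x => (x.2 + (x.1 + 1), x.2)) ?_ ?_ ?_ (fun _ _ => rfl)
    · rintro ⟨d, i⟩ _ ⟨d', i'⟩ _ he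
      simp at he ⊢
      omega
    · rintro ⟨d, i⟩ hx
      simp at hx ⊢
      omega
    · rintro ⟨i, j⟩ hp hn
      by_contra h0
      have h1 : ¬ (N ≤ i ∨ N ≤ j) := fun h2 => h0 (h i j h2)
      refine hn ⟨(i - j - 1, j), ?_, ?_⟩ <;> simp at hp ⊢ <;> omega
  rw [tsum_eq_sum (s := Finset.range M ×ˢ Finset.range M), ← hd, ← hu, ← hl]
  · simp only [Finset.sum_filter, ← Finset.sum_add_distrib]
    refine Finset.sum_congr rfl fun p _ => ?_
    split_ifs <;> omega
  · rintro ⟨i, j⟩ hp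
    apply h
    simp at hp
    omega

theorem eq_zero_of_tsum_le {N : ℕ} {ω : ℕ → ℕ → ℕ} (hs : Summable fun p : ℕ × ℕ => ω p.1 p.2)
    (h1 : ∀ i j, ω (i + 1) j ≤ ω i j) (h2 : ∀ i j, ω i (j + 1) ≤ ω i j)
    (hN : ∑' p : ℕ × ℕ, ω p.1 p.2 ≤ N) (i j : ℕ) (hij : N ≤ i ∨ N ≤ j) : ω i j = 0 := by
  by_contra h0
  have key : ∀ (m : ℕ) (g : ℕ → ℕ × ℕ), Function.Injective g →
      (∀ x ≤ m, 1 ≤ ω (g x).1 (g x).2) → m + 1 ≤ N := fun m g hg hpos => by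
    refine le_trans ?_ hN
    refine le_trans ?_ (hs.sum_le_tsum ((Finset.range (m + 1)).map ⟨g, hg⟩) fun _ _ => Nat.zero_le _)
    rw [Finset.sum_map]
    refine le_trans (by simp) (Finset.card_nsmul_le_sum _ _ 1 fun x hx => ?_)
    exact hpos x (by simp at hx; omega)
  have a1 := key i (fun x => (x, j)) (fun x y hxy => by simpa using hxy) fun x hx =>
    (Nat.one_le_iff_ne_zero.mpr h0).trans (antitone_nat_of_succ_le (f := fun i => ω i j) (fun i => h1 i j) hx)
  have a2 := key j (fun x => (i, x)) (fun x y hxy => by simpa using hxy) fun x hx =>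
    (Nat.one_le_iff_ne_zero.mpr h0).trans (antitone_nat_of_succ_le (h2 i) hx)
  omega

/-- A plane partition inside `[0, N) × [0, N)` is determined by its diagonals. -/
noncomputable def diagEquiv (N : ℕ) :
    {ω : ℕ → ℕ → ℕ // (∀ i j, ω (i + 1) j ≤ ω i j) ∧ (∀ i j, ω i (j + 1) ≤ ω i j) ∧
      ∀ i j, N ≤ i ∨ N ≤ j → ω i j = 0} ≃ DiagPair N where
  toFun ω :=
    ⟨(⟨arrayDiag N ω.1 fun i j h => ω.2.2.2 i j (Or.inl h),
        fun d i => ⟨ω.2.2.1 i (i + d), by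
          simpa [arrayDiag, add_right_comm i 1 d, add_assoc] using ω.2.1 i (i + (d + 1))⟩,
        fun d hd => Finsupp.ext fun i => ω.2.2.2 i (i + d) (Or.inr (by omega))⟩,
      ⟨arrayDiag N (fun j i => ω.1 i j) fun j i h => ω.2.2.2 i j (Or.inr h),
        fun d i => ⟨ω.2.1 (i + d) i, by
          simpa [arrayDiag, add_right_comm i 1 d, add_assoc] using ω.2.2.1 (i + (d + 1)) i⟩,
        fun d hd => Finsupp.ext fun i => ω.2.2.2 (i + d) i (Or.inl (by omega))⟩), rfl⟩
  invFun p :=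
    ⟨fun i j => if i ≤ j then p.1.1.1 (j - i) i else p.1.2.1 (i - j) j, by
      obtain ⟨⟨c, c'⟩, h⟩ := p
      replace h : c.1 0 = c'.1 0 := h
      refine ⟨fun i j => ?_, fun i j => ?_, fun i j hij => ?_⟩ <;> beta_reduce
      · rcases lt_trichotomy i j with hij | rfl | hij
        · rw [if_pos (by omega), if_pos (by omega), show j - i = j - (i + 1) + 1 by omega]
          exact (c.2.1 _ _).2
        · rw [if_neg (by omega), if_pos le_rfl, Nat.add_sub_cancel_left, Nat.sub_self, h]
          exact (c'.2.1 0 i).1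
        · rw [if_neg (by omega), if_neg (by omega), show i + 1 - j = i - j + 1 by omega]
          exact (c'.2.1 _ _).1
      · rcases lt_or_ge j i with hij | hij
        · rcases (show j + 1 = i ∨ j + 1 < i by omega) with rfl | hij'
          · rw [if_pos le_rfl, if_neg (by omega), Nat.add_sub_cancel_left, Nat.sub_self, h]
            exact (c'.2.1 0 j).2
          · rw [if_neg (by omega), if_neg (by omega), show i - j = i - (j + 1) + 1 by omega]
            exact (c'.2.1 _ _).2
        · rw [if_pos (by omega), if_pos hij, show j + 1 - i = j - i + 1 by omega]
          exact (c.2.1 _ _).1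
      · split_ifs
        · exact c.apply_eq_zero (by omega)
        · exact c'.apply_eq_zero (by omega)⟩
  left_inv ω := by
    refine Subtype.ext (funext fun i => funext fun j => ?_)
    simp only [arrayDiag, Finsupp.onFinset_apply]
    split_ifs with h
    · rw [Nat.add_sub_cancel' h]
    · rw [Nat.add_sub_cancel' (le_of_not_ge h)]
  right_inv p := by
    refine Subtype.ext (Prod.ext (Subtype.ext (funext fun d => Finsupp.ext fun i => ?_))
      (Subtype.ext (funext fun d => Finsupp.ext fun i => ?_)))
    · simp [arrayDiag]
    · simp only [arrayDiag, Finsupp.onFinset_apply]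
      rcases d with _ | d
      · simp [p.2]
      · rw [if_neg (by omega), Nat.add_sub_cancel_left]

theorem size_diagEquiv {N : ℕ} (ω : {ω : ℕ → ℕ → ℕ // (∀ i j, ω (i + 1) j ≤ ω i j) ∧
    (∀ i j, ω i (j + 1) ≤ ω i j) ∧ ∀ i j, N ≤ i ∨ N ≤ j → ω i j = 0}) :
    (diagEquiv N ω).size = ∑' p : ℕ × ℕ, ω.1 p.1 p.2 := by
  rw [tsum_eq_sum_diagonals ω.2.2.2, DiagPair.size]
  have h : ∀ i, N ≤ i → ∀ j, ω.1 i j = 0 ∧ ω.1 j i = 0 := fun i hi j =>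
    ⟨ω.2.2.2 i j (Or.inl hi), ω.2.2.2 j i (Or.inr hi)⟩
  congr 1
  · congr 1
    · exact degree_eq_sum_range _ fun i hi => (h i hi _).1
    · exact Finset.sum_congr rfl fun d _ => degree_eq_sum_range _ fun i hi => (h i hi _).1
  · exact Finset.sum_congr rfl fun d _ => degree_eq_sum_range _ fun i hi => (h i hi _).2

theorem planePartitionCount_eq {N n : ℕ} (hn : 1 ≤ n) (hnN : n ≤ N) :
    planePartitionCount n = PowerSeries.coeff n
      (∏ p ∈ Finset.range N ×ˢ Finset.range N, geomNat (p.1 + p.2 + 1)) := by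
  rw [← card_diagPair, planePartitionCount]
  refine Nat.card_congr (Equiv.trans ?_ ((diagEquiv N).subtypeEquiv
    (p := fun ω => ∑' p : ℕ × ℕ, ω.1 p.1 p.2 = n) fun ω => by rw [size_diagEquiv]))
  refine (Equiv.subtypeEquivRight fun ω => ?_).trans
    (Equiv.subtypeSubtypeEquivSubtypeInter (fun ω : ℕ → ℕ → ℕ => (∀ i j, ω (i + 1) j ≤ ω i j) ∧
      (∀ i j, ω i (j + 1) ≤ ω i j) ∧ ∀ i j, N ≤ i ∨ N ≤ j → ω i j = 0)
      fun ω => ∑' p : ℕ × ℕ, ω p.1 p.2 = n).symm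
  constructor
  · rintro ⟨h1, h2, h3⟩
    refine ⟨⟨h1, h2, eq_zero_of_tsum_le ?_ h1 h2 (h3.trans_le hnN)⟩, h3⟩
    by_contra hs
    rw [tsum_eq_zero_of_not_summable hs] at h3
    omega
  · rintro ⟨⟨h1, h2, _⟩, h3⟩
    exact ⟨h1, h2, h3⟩

theorem q_eq_coeff {N n : ℕ} (hnN : n ≤ N) :
    q n = PowerSeries.coeff n
      (∏ p ∈ Finset.range N ×ˢ Finset.range N, geomNat (p.1 + p.2 + 1)) := by
  rcases Nat.eq_zero_or_pos n with rfl | hn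
  · rw [q, if_pos rfl, PowerSeries.coeff_zero_eq_constantCoeff, map_prod, Finset.prod_eq_one]
    intro p _
    simp [geomNat, ← PowerSeries.coeff_zero_eq_constantCoeff_apply]
  · rw [q, if_neg (by omega), planePartitionCount_eq hn hnN]

/-- The recurrence `n q(n) = Σ_{k=1}^n q(n-k) β₂(k)`. -/
theorem plane_partition_recurrence (n : ℕ) (hn : 1 ≤ n) :
    n * q n = ∑ k ∈ Finset.Icc 1 n, q (n - k) * beta2 k := by
  rw [q_eq_coeff le_rfl]
  simp only [q_eq_coeff (N := n) (Nat.sub_le n _)]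
  exact mul_coeff_prod_geomNat hn le_rfl
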